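/- The access policies PRV and SMC ∅ are equivalent: for every scope graph G, scope s, and path p in G, G, s ⊢ p ! PRV holds if and only if G, s ⊢ p ! SMC ∅ holds. -/

import Mathlib

/-- Edge labels of a scope graph. -/
inductive Label where
  | LEX | IMP | EXT | MOD | CLS | VAR | THIS_M | THIS_C
deriving DecidableEq

/-- A scope graph: a set of scopes together with labeled directed edges. -/
structure ScopeGraph (Scope : Type) where
  scopes : Set Scope
  edge : Scope → Label → Scope → Prop

/-- A path in a scope graph: a nonempty alternating sequence of scopes and labels
    following edges of the graph, indexed by its source scope. -/
inductive SGPath {Scope : Type} (G : ScopeGraph Scope) : Scope → Type where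
  | single (s : Scope) : SGPath G s
  | cons (s : Scope) (l : Label) {s' : Scope} (h : G.edge s l s') (p : SGPath G s') : SGPath G s

/-- The final (target) scope of a path. -/
def SGPath.tgt {Scope : Type} {G : ScopeGraph Scope} {s : Scope} : SGPath G s → Scope
  | .single s => s
  | .cons _ _ _ p => p.tgt

/-- The set of scopes occurring in a path. -/
def SGPath.scopes {Scope : Type} {G : ScopeGraph Scope} {s : Scope} : SGPath G s → Set Scope
  | .single s => {s}
  | .cons s _ _ p => insert s p.scopes

/-- Access policies. -/
inductive Policy (Scope : Type) where
  | PUB | PRV | PRT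
  | MOD (S : Set Scope)
  | SMD (S : Set Scope)
  | SMC (S : Set Scope)

/-- Reachability via a (possibly empty) sequence of LEX-labeled edges. -/
def lexReach {Scope : Type} (G : ScopeGraph Scope) : Scope → Scope → Prop :=
  Relation.ReflTransGen (fun a b => G.edge a Label.LEX b)

/-- `encC G s S_C`: `S_C` is the set of enclosing class scopes of `s`, i.e. the scopes
    reachable from `s` by a sequence of LEX edges followed by one THIS_C self-edge. -/
def encC {Scope : Type} (G : ScopeGraph Scope) (s : Scope) (SC : Set Scope) : Prop :=
  SC = { sc | lexReach G s sc ∧ G.edge sc Label.THIS_C sc }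

/-- `lexN G n a b`: `b` is reachable from `a` by exactly `n` LEX-labeled edges. -/
def lexN {Scope : Type} (G : ScopeGraph Scope) : ℕ → Scope → Scope → Prop
  | 0, a, b => a = b
  | n + 1, a, b => ∃ c, G.edge a Label.LEX c ∧ lexN G n c b

/-- `encMI G s s_m`: `s_m` is the innermost enclosing module of `s`, i.e. it is reached
    from `s` by the shortest sequence of LEX edges ending in a scope with a THIS_M
    self-edge. -/
def encMI {Scope : Type} (G : ScopeGraph Scope) (s sm : Scope) : Prop :=
  ∃ n, lexN G n s sm ∧ G.edge sm Label.THIS_M sm ∧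
    ∀ m < n, ∀ t, lexN G m s t → ¬ G.edge t Label.THIS_M t

/-- The access-permission judgment `G, s ⊢ p ! A`. -/
inductive Access {Scope : Type} (G : ScopeGraph Scope) (s : Scope) {sp : Scope}
    (p : SGPath G sp) : Policy Scope → Prop where
  | pub : Access G s p .PUB
  | int {S : Set Scope} {sm : Scope} :
      encMI G s sm → sm ∈ S → Access G s p (.MOD S)
  | prot {SC : Set Scope} {sc : Scope} :
      encC G s SC → sc ∈ SC → sc ∈ p.scopes → Access G s p .PRT
  | priv {A : Policy Scope} {SC : Set Scope} :
      encC G s SC → p.tgt ∈ SC → Access G s p A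
  | smdProt {S : Set Scope} : Access G s p .PRT → Access G s p (.SMD S)
  | smdMod {S : Set Scope} : Access G s p (.MOD S) → Access G s p (.SMD S)
  | smc {S : Set Scope} :
      Access G s p (.MOD S) → Access G s p .PRT → Access G s p (.SMC S)

/-- `PRV ≡ SMC ∅`. -/
theorem prv_equiv_smc_empty {Scope : Type} (G : ScopeGraph Scope) (s : Scope) {sp : Scope}
    (p : SGPath G sp) :
    Access G s p Policy.PRV ↔ Access G s p (Policy.SMC (∅ : Set Scope)) := by
  constructor
  · intro h
    cases h with
    | priv h1 h2 => exact Access.priv h1 h2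
  · intro h
    cases h with
    | priv h1 h2 => exact Access.priv h1 h2
    | smc hm _ =>
      cases hm with
      | int _ h => exact absurd h (Set.notMem_empty _)
      | priv h1 h2 => exact Access.priv h1 h2
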